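/- Let d ≥ 0 be an integer and a, b, c ∈ F, and suppose the ℜ-module R_d(a,b,c) is irreducible. Let (X,x) denote any one of (A,a), (B,b), (C,c). Then the following are equivalent: (i) X acts diagonalizably on R_d(a,b,c); (ii) X acts multiplicity-freely on R_d(a,b,c); (iii) 2x does not belong to the set {i − d − 1 : i = 1, 2, …, 2d−1}. -/

import Mathlib

open FreeAlgebra

noncomputable section

variable (F : Type) [Field F]

/-! ## The universal Racah algebra -/

/-- `α = [A,D] + AC - BA` in the free algebra on `A,B,C,D`. -/
def alphaFree : FreeAlgebra F (Fin 4) :=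
  ι F 0 * ι F 3 - ι F 3 * ι F 0 + ι F 0 * ι F 2 - ι F 1 * ι F 0

/-- `β = [B,D] + BA - CB` in the free algebra on `A,B,C,D`. -/
def betaFree : FreeAlgebra F (Fin 4) :=
  ι F 1 * ι F 3 - ι F 3 * ι F 1 + ι F 1 * ι F 0 - ι F 2 * ι F 1

/-- `γ = [C,D] + CB - AC` in the free algebra on `A,B,C,D`. -/
def gammaFree : FreeAlgebra F (Fin 4) :=
  ι F 2 * ι F 3 - ι F 3 * ι F 2 + ι F 2 * ι F 1 - ι F 0 * ι F 2

/-- The defining relations of the universal Racah algebra: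
`[A,B] = [B,C] = [C,A] = 2D` and `α`, `β`, `γ` commute with the generators. -/
inductive RacahRel : FreeAlgebra F (Fin 4) → FreeAlgebra F (Fin 4) → Prop
  | AB : RacahRel (ι F 0 * ι F 1 - ι F 1 * ι F 0) (2 * ι F 3)
  | BC : RacahRel (ι F 1 * ι F 2 - ι F 2 * ι F 1) (2 * ι F 3)
  | CA : RacahRel (ι F 2 * ι F 0 - ι F 0 * ι F 2) (2 * ι F 3)
  | alphaC (i : Fin 4) : RacahRel (alphaFree F * ι F i) (ι F i * alphaFree F)
  | betaC (i : Fin 4) : RacahRel (betaFree F * ι F i) (ι F i * betaFree F)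
  | gammaC (i : Fin 4) : RacahRel (gammaFree F * ι F i) (ι F i * gammaFree F)

/-- The universal Racah algebra `ℜ`. -/
abbrev RacahAlg := RingQuot (RacahRel F)

def rA : RacahAlg F := RingQuot.mkAlgHom F (RacahRel F) (ι F 0)
def rB : RacahAlg F := RingQuot.mkAlgHom F (RacahRel F) (ι F 1)
def rC : RacahAlg F := RingQuot.mkAlgHom F (RacahRel F) (ι F 2)
def rD : RacahAlg F := RingQuot.mkAlgHom F (RacahRel F) (ι F 3)
def rDelta : RacahAlg F := rA F + rB F + rC F
def rAlpha : RacahAlg F := RingQuot.mkAlgHom F (RacahRel F) (alphaFree F)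
def rBeta : RacahAlg F := RingQuot.mkAlgHom F (RacahRel F) (betaFree F)
def rGamma : RacahAlg F := RingQuot.mkAlgHom F (RacahRel F) (gammaFree F)

/-! ## The universal additive DAHA of type `(C₁∨, C₁)` -/

/-- The defining relations: `t₀ + t₁ + t₂ + t₃ = -1` and each `tᵢ²` is central. -/
inductive DAHARel : FreeAlgebra F (Fin 4) → FreeAlgebra F (Fin 4) → Prop
  | sum : DAHARel (ι F 0 + ι F 1 + ι F 2 + ι F 3) (-1)
  | central (i j : Fin 4) : DAHARel (ι F i * ι F i * ι F j) (ι F j * (ι F i * ι F i))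

/-- The universal additive DAHA `𝔥` of type `(C₁∨, C₁)`. -/
abbrev DAHAAlg := RingQuot (DAHARel F)

/-- The generators `t₀, t₁, t₂, t₃` of `𝔥`. -/
def tGen (i : Fin 4) : DAHAAlg F := RingQuot.mkAlgHom F (DAHARel F) (ι F i)

/-! ## Scalar restriction along `algebraMap`, actions as `F`-linear operators -/

/-- The `F`-vector space structure on a module over an `F`-algebra `A`. -/
def resF (A : Type) [Ring A] [Algebra F A] (W : Type) [AddCommGroup W] [Module A W] :
    Module F W := Module.compHom W (algebraMap F A)

theorem resF_tower (A : Type) [Ring A] [Algebra F A] (W : Type) [AddCommGroup W] [Module A W]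
    [instF : Module F W] (h : instF = resF F A W) : IsScalarTower F A W := by
  have key : ∀ (a : F) (u : W), a • u = algebraMap F A a • u := by
    intro a u; rw [h]; rfl
  exact ⟨fun a x w => by rw [Algebra.smul_def, mul_smul, key a (x • w)]⟩

/-- The action of `x : A` on an `A`-module `W` as an `F`-linear operator. -/
def opOf {A : Type} [Ring A] [Algebra F A] (x : A) (W : Type) [AddCommGroup W] [Module F W]
    [Module A W] [IsScalarTower F A W] : Module.End F W where
  toFun w := x • w
  map_add' u v := smul_add x u v
  map_smul' a w := by
    simp only [RingHom.id_apply]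
    rw [← algebraMap_smul A a w, ← mul_smul, ← Algebra.commutes, mul_smul, algebraMap_smul]

/-- `x : A` acts diagonalizably on the `A`-module `W`. -/
def ActsDiagOn {A : Type} [Ring A] [Algebra F A] (x : A) (W : Type) [AddCommGroup W]
    [Module A W] : Prop :=
  letI := resF F A W
  haveI := resF_tower F A W rfl
  (⨆ μ : F, Module.End.eigenspace (opOf F x W) μ) = ⊤

/-- `x : A` acts on the `A`-module `W` in a multiplicity-free way: every eigenvalue of the
action of `x` has algebraic multiplicity one. -/
def ActsMultFreeOn {A : Type} [Ring A] [Algebra F A] (x : A) (W : Type) [AddCommGroup W]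
    [Module A W] : Prop :=
  letI := resF F A W
  haveI := resF_tower F A W rfl
  ∀ μ : F, Module.End.HasEigenvalue (opOf F x W) μ →
    Module.finrank F (Module.End.maxGenEigenspace (opOf F x W) μ) = 1

/-- `x : A` acts on the `A`-module `W` as scalar multiplication by `μ : F`. -/
def actsAsScalar {A : Type} [Ring A] [Algebra F A] (x : A) (μ : F) (W : Type)
    [AddCommGroup W] [Module A W] : Prop :=
  letI := resF F A W
  ∀ u : W, x • u = μ • u

/-- The trace of the action of `x : A` on the `A`-module `W`. -/
def traceOf {A : Type} [Ring A] [Algebra F A] (x : A) (W : Type) [AddCommGroup W]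
    [Module A W] : F :=
  letI := resF F A W
  haveI := resF_tower F A W rfl
  LinearMap.trace F W (opOf F x W)

/-! ## Tridiagonal matrices, Leonard pairs and Leonard triples -/

/-- A square matrix is tridiagonal if each nonzero entry lies on the diagonal, the
superdiagonal, or the subdiagonal. -/
def IsTridiag {n : ℕ} (M : Matrix (Fin n) (Fin n) F) : Prop :=
  ∀ i j : Fin n, M i j ≠ 0 → (i : ℕ) = (j : ℕ) ∨ (i : ℕ) = (j : ℕ) + 1 ∨ (j : ℕ) = (i : ℕ) + 1

/-- A tridiagonal matrix is irreducible if every superdiagonal and subdiagonal entry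
is nonzero. -/
def IsIrrTridiag {n : ℕ} (M : Matrix (Fin n) (Fin n) F) : Prop :=
  IsTridiag F M ∧ ∀ i j : Fin n, ((i : ℕ) = (j : ℕ) + 1 ∨ (j : ℕ) = (i : ℕ) + 1) → M i j ≠ 0

/-- `x, y : A` act on the `A`-module `W` as a Leonard pair. -/
def ActsAsLeonardPairOn {A : Type} [Ring A] [Algebra F A] (x y : A) (W : Type)
    [AddCommGroup W] [Module A W] : Prop :=
  letI := resF F A W
  haveI := resF_tower F A W rfl
  (∃ (n : ℕ) (b : Module.Basis (Fin n) F W),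
      (LinearMap.toMatrix b b (opOf F x W)).IsDiag ∧
      IsIrrTridiag F (LinearMap.toMatrix b b (opOf F y W))) ∧
  (∃ (n : ℕ) (b : Module.Basis (Fin n) F W),
      (LinearMap.toMatrix b b (opOf F y W)).IsDiag ∧
      IsIrrTridiag F (LinearMap.toMatrix b b (opOf F x W)))

/-- `x, y, z : A` act on the `A`-module `W` as a Leonard triple. -/
def ActsAsLeonardTripleOn {A : Type} [Ring A] [Algebra F A] (x y z : A) (W : Type)
    [AddCommGroup W] [Module A W] : Prop :=
  letI := resF F A W
  haveI := resF_tower F A W rfl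
  (∃ (n : ℕ) (b : Module.Basis (Fin n) F W),
      (LinearMap.toMatrix b b (opOf F x W)).IsDiag ∧
      IsIrrTridiag F (LinearMap.toMatrix b b (opOf F y W)) ∧
      IsIrrTridiag F (LinearMap.toMatrix b b (opOf F z W))) ∧
  (∃ (n : ℕ) (b : Module.Basis (Fin n) F W),
      (LinearMap.toMatrix b b (opOf F y W)).IsDiag ∧
      IsIrrTridiag F (LinearMap.toMatrix b b (opOf F z W)) ∧
      IsIrrTridiag F (LinearMap.toMatrix b b (opOf F x W))) ∧
  (∃ (n : ℕ) (b : Module.Basis (Fin n) F W),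
      (LinearMap.toMatrix b b (opOf F z W)).IsDiag ∧
      IsIrrTridiag F (LinearMap.toMatrix b b (opOf F x W)) ∧
      IsIrrTridiag F (LinearMap.toMatrix b b (opOf F y W)))

/-! ## The irreducible `ℜ`-modules `R_d(a,b,c)` -/

/-- `θᵢ = (x + d/2 - i)(x + d/2 - i + 1)`. -/
def thP (x : F) (d i : ℕ) : F := (x + (d : F) / 2 - (i : F)) * (x + (d : F) / 2 - (i : F) + 1)

/-- `φᵢ = i(i-d-1)(a+b+c+d/2-i+2)(a+b-c+d/2-i+1)`. -/
def phP (a b c : F) (d i : ℕ) : F :=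
  (i : F) * ((i : F) - (d : F) - 1) * (a + b + c + (d : F) / 2 - (i : F) + 2) *
    (a + b - c + (d : F) / 2 - (i : F) + 1)

/-- `W` is (a copy of) the `(d+1)`-dimensional `ℜ`-module `R_d(a,b,c)`:  there is a basis
with respect to which `A` is lower bidiagonal with diagonal `θᵢ` and subdiagonal entries `1`,
`B` is upper bidiagonal with diagonal `θᵢ*` and superdiagonal entries `φᵢ`, and `δ` acts as
the prescribed scalar. -/
def IsRdModule (a b c : F) (d : ℕ) (W : Type) [AddCommGroup W] [Module (RacahAlg F) W] :
    Prop :=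
  letI := resF F (RacahAlg F) W
  ∃ v : Module.Basis (Fin (d + 1)) F W,
    (∀ i : Fin (d + 1), rA F • (v i : W) = thP F a d i • v i +
      (if h : (i : ℕ) + 1 < d + 1 then v ⟨(i : ℕ) + 1, h⟩ else 0)) ∧
    (∀ i : Fin (d + 1), rB F • (v i : W) = thP F b d i • v i +
      (if (i : ℕ) = 0 then 0 else
        phP F a b c d i • v ⟨(i : ℕ) - 1, lt_of_le_of_lt (Nat.sub_le _ _) i.isLt⟩)) ∧
    actsAsScalar F (rDelta F)
      ((d : F) / 2 * ((d : F) / 2 + 1) + a * (a + 1) + b * (b + 1) + c * (c + 1)) W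

/-! ## The homomorphism `ζ : ℜ → 𝔥` -/

/-- `ζ : ℜ → 𝔥` sends `A, B, C` to the prescribed elements of `𝔥`. -/
def IsZeta (ζ : RacahAlg F →ₐ[F] DAHAAlg F) : Prop :=
  ζ (rA F) = (1 / 4 : F) • ((tGen F 0 + tGen F 1 - 1) * (tGen F 0 + tGen F 1 + 1)) ∧
  ζ (rB F) = (1 / 4 : F) • ((tGen F 0 + tGen F 2 - 1) * (tGen F 0 + tGen F 2 + 1)) ∧
  ζ (rC F) = (1 / 4 : F) • ((tGen F 0 + tGen F 3 - 1) * (tGen F 0 + tGen F 3 + 1))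

/-- A `𝔥`-module considered as an `ℜ`-module via `ζ : ℜ → 𝔥`. -/
def racahModOfDaha (ζ : RacahAlg F →ₐ[F] DAHAAlg F) (V : Type) [AddCommGroup V]
    [Module (DAHAAlg F) V] : Module (RacahAlg F) V :=
  Module.compHom V ζ.toRingHom

/-! ## Composition factors -/

/-- The `i`-th factor of a composition series of submodules. -/
abbrev csFactor {R V : Type} [Ring R] [AddCommGroup V] [Module R V]
    (s : CompositionSeries (Submodule R V)) (i : Fin s.length) : Type :=
  (↥(s i.succ)) ⧸ Submodule.comap (s i.succ).subtype (s i.castSucc)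

/-! ## The `𝔥`-modules `E_d(a,b,c)` and `O_d(a,b,c)` -/

def sigP (a b c : F) (d : ℕ) : F := a + b + c - ((d : F) + 1) / 2
def tauP (a b c : F) (d : ℕ) : F := a + b - c - ((d : F) + 1) / 2
def lamP (a b c : F) (d : ℕ) : F := a - b - c - ((d : F) + 1) / 2
def muP (a b c : F) (d : ℕ) : F := c - a - b - ((d : F) + 1) / 2
def nuP (a b c : F) (d : ℕ) : F := b - a - c - ((d : F) + 1) / 2

/-- `W` is (a copy of) the `(d+1)`-dimensional `𝔥`-module `E_d(a,b,c)` (`d` odd):  there is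
a basis `v₀, …, v_d` (extended by zero to a sequence `w`) on which `t₀, t₁, t₂, t₃` act by the
prescribed formulas. -/
def IsEdModule (a b c : F) (d : ℕ) (W : Type) [AddCommGroup W] [Module (DAHAAlg F) W] :
    Prop :=
  letI := resF F (DAHAAlg F) W
  ∃ (v : Module.Basis (Fin (d + 1)) F W) (w : ℕ → W),
    (∀ i : Fin (d + 1), w i = v i) ∧ (∀ n : ℕ, d < n → w n = 0) ∧
    (∀ i : ℕ, Even i → 2 ≤ i → i + 1 ≤ d →
      tGen F 0 • w i = ((i : F) * ((d : F) - (i : F) + 1)) • w (i - 1)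
        - (((d : F) - 2 * (i : F) + 1) / 2) • w i) ∧
    (∀ i : ℕ, Odd i → i + 2 ≤ d →
      tGen F 0 • w i = (((d : F) - 2 * (i : F) - 1) / 2) • w i + w (i + 1)) ∧
    (tGen F 0 • w 0 = -(((d : F) + 1) / 2) • w 0) ∧
    (tGen F 0 • w d = -(((d : F) + 1) / 2) • w d) ∧
    (∀ i : ℕ, Even i → 2 ≤ i → i + 1 ≤ d →
      tGen F 1 • w i = ((i : F) * ((i : F) - (d : F) - 1)) • w (i - 1) + a • w i + w (i + 1)) ∧
    (∀ i : ℕ, Odd i → i ≤ d → tGen F 1 • w i = -a • w i) ∧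
    (tGen F 1 • w 0 = a • w 0 + w 1) ∧
    (∀ i : ℕ, Even i → i + 1 ≤ d → tGen F 2 • w i = b • w i) ∧
    (∀ i : ℕ, Odd i → i + 2 ≤ d →
      tGen F 2 • w i = -((sigP F a b c d + (i : F)) * (tauP F a b c d + (i : F))) • w (i - 1)
        - b • w i - w (i + 1)) ∧
    (tGen F 2 • w d = -((sigP F a b c d + (d : F)) * (tauP F a b c d + (d : F))) • w (d - 1)
      - b • w d) ∧
    (∀ i : ℕ, Even i → i + 1 ≤ d →
      tGen F 3 • w i = -((sigP F a b c d + tauP F a b c d + 2 * (i : F) + 2) / 2) • w i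
        - w (i + 1)) ∧
    (∀ i : ℕ, Odd i → i ≤ d →
      tGen F 3 • w i = ((sigP F a b c d + (i : F)) * (tauP F a b c d + (i : F))) • w (i - 1)
        + ((sigP F a b c d + tauP F a b c d + 2 * (i : F)) / 2) • w i)

/-- On `E_d(a,b,c)` the elements `t₀², t₁², t₂², t₃²` act as scalar multiplication by
`(d+1)²/4, a², b², c²` respectively. -/
def EdSquares (a b c : F) (d : ℕ) (W : Type) [AddCommGroup W] [Module (DAHAAlg F) W] :
    Prop :=
  actsAsScalar F (tGen F 0 * tGen F 0) (((d : F) + 1) ^ 2 / 4) W ∧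
  actsAsScalar F (tGen F 1 * tGen F 1) (a ^ 2) W ∧
  actsAsScalar F (tGen F 2 * tGen F 2) (b ^ 2) W ∧
  actsAsScalar F (tGen F 3 * tGen F 3) (c ^ 2) W

/-- `W` is (a copy of) the `(d+1)`-dimensional `𝔥`-module `O_d(a,b,c)` (`d` even):  there is
a basis `v₀, …, v_d` (extended by zero to a sequence `w`) on which `t₀, t₁, t₂, t₃` act by the
prescribed formulas. -/
def IsOdModule (a b c : F) (d : ℕ) (W : Type) [AddCommGroup W] [Module (DAHAAlg F) W] :
    Prop :=
  letI := resF F (DAHAAlg F) W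
  ∃ (v : Module.Basis (Fin (d + 1)) F W) (w : ℕ → W),
    (∀ i : Fin (d + 1), w i = v i) ∧ (∀ n : ℕ, d < n → w n = 0) ∧
    (∀ i : ℕ, Even i → 2 ≤ i → i ≤ d →
      tGen F 0 • w i = -((i : F) * (sigP F a b c d + (i : F))) • w (i - 1)
        + ((sigP F a b c d + 2 * (i : F)) / 2) • w i) ∧
    (∀ i : ℕ, Odd i → i + 1 ≤ d →
      tGen F 0 • w i = -((sigP F a b c d + 2 * (i : F) + 2) / 2) • w i + w (i + 1)) ∧
    (tGen F 0 • w 0 = (sigP F a b c d / 2) • w 0) ∧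
    (∀ i : ℕ, Even i → 2 ≤ i → i + 2 ≤ d →
      tGen F 1 • w i = ((i : F) * (sigP F a b c d + (i : F))) • w (i - 1)
        + (lamP F a b c d / 2) • w i + w (i + 1)) ∧
    (∀ i : ℕ, Odd i → i + 1 ≤ d → tGen F 1 • w i = -(lamP F a b c d / 2) • w i) ∧
    (tGen F 1 • w 0 = (lamP F a b c d / 2) • w 0 + w 1) ∧
    (tGen F 1 • w d = ((d : F) * (sigP F a b c d + (d : F))) • w (d - 1)
      + (lamP F a b c d / 2) • w d) ∧
    (∀ i : ℕ, Even i → i ≤ d → tGen F 2 • w i = (nuP F a b c d / 2) • w i) ∧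
    (∀ i : ℕ, Odd i → i + 1 ≤ d →
      tGen F 2 • w i = (((d : F) - (i : F) - 1) * (tauP F a b c d + (i : F))) • w (i - 1)
        - (nuP F a b c d / 2) • w i - w (i + 1)) ∧
    (∀ i : ℕ, Even i → i + 2 ≤ d →
      tGen F 3 • w i = ((2 * (d : F) + muP F a b c d - 2 * (i : F)) / 2) • w i - w (i + 1)) ∧
    (∀ i : ℕ, Odd i → i + 1 ≤ d →
      tGen F 3 • w i = (((i : F) - (d : F) - 1) * (tauP F a b c d + (i : F))) • w (i - 1)
        - ((2 * (d : F) + muP F a b c d - 2 * (i : F) + 2) / 2) • w i) ∧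
    (tGen F 3 • w d = (muP F a b c d / 2) • w d)

/-- On `O_d(a,b,c)` the elements `t₀², t₁², t₂², t₃²` act as the prescribed scalars. -/
def OdSquares (a b c : F) (d : ℕ) (W : Type) [AddCommGroup W] [Module (DAHAAlg F) W] :
    Prop :=
  actsAsScalar F (tGen F 0 * tGen F 0) (((a + b + c) / 2 - ((d : F) + 1) / 4) ^ 2) W ∧
  actsAsScalar F (tGen F 1 * tGen F 1) (((a - b - c) / 2 - ((d : F) + 1) / 4) ^ 2) W ∧
  actsAsScalar F (tGen F 2 * tGen F 2) (((c - a - b) / 2 - ((d : F) + 1) / 4) ^ 2) W ∧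
  actsAsScalar F (tGen F 3 * tGen F 3) (((b - a - c) / 2 - ((d : F) + 1) / 4) ^ 2) W

/-! ## The `{±1}²`-action on `𝔥` and twisted modules -/

theorem dahaSum : tGen F 0 + tGen F 1 + tGen F 2 + tGen F 3 = -1 := by
  have h := RingQuot.mkAlgHom_rel F (DAHARel.sum (F := F))
  simpa [tGen] using h

theorem dahaSqCentral (i j : Fin 4) :
    tGen F i * tGen F i * tGen F j = tGen F j * (tGen F i * tGen F i) := by
  have h := RingQuot.mkAlgHom_rel F (DAHARel.central (F := F) i j)
  simpa [tGen] using h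

/-- The algebra endomorphism of `𝔥` permuting the generators `t₀, t₁, t₂, t₃` by `π`. -/
def dahaAut (π : Equiv.Perm (Fin 4)) : DAHAAlg F →ₐ[F] DAHAAlg F :=
  RingQuot.liftAlgHom F ⟨FreeAlgebra.lift F (fun i => tGen F (π i)), by
    intro x y h
    cases h with
    | sum =>
        simp only [map_add, map_neg, map_one, FreeAlgebra.lift_ι_apply]
        have h4 : tGen F (π 0) + tGen F (π 1) + tGen F (π 2) + tGen F (π 3)
            = ∑ k : Fin 4, tGen F (π k) := by rw [Fin.sum_univ_four]
        rw [h4, Equiv.sum_comp π (tGen F), Fin.sum_univ_four, dahaSum]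
    | central i j =>
        simp only [map_mul, FreeAlgebra.lift_ι_apply]
        exact dahaSqCentral F (π i) (π j)⟩

/-- The element of the Klein group `{±1}²` acting on `𝔥` as the permutation of
`(t₀, t₁, t₂, t₃)` from Table 1. -/
def permOf (ε : ℤˣ × ℤˣ) : Equiv.Perm (Fin 4) :=
  if ε = (1, 1) then 1
  else if ε = (1, -1) then Equiv.swap 0 1 * Equiv.swap 2 3
  else if ε = (-1, 1) then Equiv.swap 0 2 * Equiv.swap 1 3
  else Equiv.swap 0 3 * Equiv.swap 1 2

/-- The `𝔥`-module `W^ε`: the underlying space of `W` with the action twisted by the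
automorphism of `𝔥` given by the permutation `π` of the generators. -/
def twMod (π : Equiv.Perm (Fin 4)) (W : Type) [AddCommGroup W] [Module (DAHAAlg F) W] :
    Module (DAHAAlg F) W :=
  Module.compHom W (dahaAut F π).toRingHom

/-- The trace of `x` on the twisted module `W^π`. -/
def twTrace (π : Equiv.Perm (Fin 4)) (x : DAHAAlg F) (W : Type) [AddCommGroup W]
    [Module (DAHAAlg F) W] : F :=
  @traceOf F _ (DAHAAlg F) _ _ x W _ (twMod F π W)

/-- `x` acts on the twisted module `W^π` as scalar multiplication by `μ`. -/
def twActsAsScalar (π : Equiv.Perm (Fin 4)) (x : DAHAAlg F) (μ : F) (W : Type)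
    [AddCommGroup W] [Module (DAHAAlg F) W] : Prop :=
  @actsAsScalar F _ (DAHAAlg F) _ _ x μ W _ (twMod F π W)

/-- The twisted module `W^π` is (a copy of) `E_d(a,b,c)`. -/
def twIsEdModule (π : Equiv.Perm (Fin 4)) (a b c : F) (d : ℕ) (W : Type) [AddCommGroup W]
    [Module (DAHAAlg F) W] : Prop :=
  @IsEdModule F _ a b c d W _ (twMod F π W)

end

/-- A lower bidiagonal operator with unit subdiagonal: `w 0` is a cyclic vector. -/
structure IsBidiagChain {F V : Type} [Field F] [AddCommGroup V] [Module F V]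
    (T : Module.End F V) (d : ℕ) (ε : ℕ → F) (w : ℕ → V) : Prop where
  step : ∀ k ≤ d, w (k + 1) = T (w k) - ε k • w k
  last : w (d + 1) = 0
  span : ∀ v : V, v ∈ Submodule.span F (w '' Set.Iic d)

theorem finrank_finset_sup_le {F V ι : Type*} [Field F] [AddCommGroup V] [Module F V]
    [FiniteDimensional F V] (s : Finset ι) (E : ι → Submodule F V)
    (h : ∀ i ∈ s, Module.finrank F (E i) ≤ 1) :
    Module.finrank F (s.sup E : Submodule F V) ≤ s.card := by
  classical
  induction s using Finset.induction_on with
  | empty => simp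
  | insert i s hi ih =>
    rw [Finset.sup_insert, Finset.card_insert_of_notMem hi]
    have h1 := Submodule.finrank_add_le_finrank_add_finrank (E i) (s.sup E)
    have h2 := h i (Finset.mem_insert_self i s)
    have h3 := ih fun j hj => h j (Finset.mem_insert_of_mem hj)
    omega

namespace IsBidiagChain

variable {F V : Type} [Field F] [AddCommGroup V] [Module F V]
  {T : Module.End F V} {d : ℕ} {ε : ℕ → F} {w : ℕ → V}

open Polynomial

theorem aeval_prod_apply (h : IsBidiagChain T d ε w) {k : ℕ} (hk : k ≤ d + 1) :
    aeval T (∏ j ∈ Finset.range k, (X - C (ε j))) (w 0) = w k := by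
  induction k with
  | zero => simp
  | succ k ih =>
    rw [Finset.prod_range_succ, mul_comm, map_mul, Module.End.mul_apply, ih (by omega),
      h.step k (by omega)]
    simp

theorem aeval_prod_eq_zero (h : IsBidiagChain T d ε w) :
    aeval T (∏ j ∈ Finset.range (d + 1), (X - C (ε j))) = 0 := by
  ext v
  induction h.span v using Submodule.span_induction with
  | mem x hx =>
    obtain ⟨k, hk, rfl⟩ := hx
    rw [← h.aeval_prod_apply (k := k) (by simp at hk; omega), ← Module.End.mul_apply, ← map_mul,
      mul_comm, map_mul, Module.End.mul_apply, h.aeval_prod_apply le_rfl, h.last]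
    simp
  | zero => simp
  | add x y _ _ hx hy => simp_all
  | smul r x _ hx => simp_all

theorem exists_eq_of_hasEigenvalue (h : IsBidiagChain T d ε w) {μ : F} (hμ : T.HasEigenvalue μ) :
    ∃ k ∈ Finset.range (d + 1), ε k = μ := by
  obtain ⟨x, hx⟩ := hμ.exists_hasEigenvector
  have h1 := Module.End.aeval_apply_of_hasEigenvector
    (p := ∏ j ∈ Finset.range (d + 1), (X - C (ε j))) hx
  rw [h.aeval_prod_eq_zero, LinearMap.zero_apply] at h1
  have h2 := (smul_eq_zero.mp h1.symm).resolve_right hx.2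
  rw [eval_prod, Finset.prod_eq_zero_iff] at h2
  obtain ⟨k, hk, h3⟩ := h2
  refine ⟨k, hk, ?_⟩
  simp only [eval_sub, eval_X, eval_C] at h3
  exact (sub_eq_zero.mp h3).symm

theorem finrank_eigenspace_le_one [FiniteDimensional F V] (h : IsBidiagChain T d ε w) (μ : F) :
    Module.finrank F (T.eigenspace μ) ≤ 1 := by
  have key : ∀ k ≤ d, w k ∈ LinearMap.range (T - μ • 1) ⊔ Submodule.span F {w 0} := by
    intro k
    induction k with
    | zero => exact fun _ => Submodule.mem_sup_right (Submodule.mem_span_singleton_self _)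
    | succ k ih =>
      intro hk
      have h1 : w (k + 1) = (T - μ • (1 : Module.End F V)) (w k) + (μ - ε k) • w k := by
        rw [h.step k (by omega)]
        simp only [LinearMap.sub_apply, LinearMap.smul_apply, Module.End.one_apply]
        module
      rw [h1]
      exact Submodule.add_mem _ (Submodule.mem_sup_left (LinearMap.mem_range_self _ _))
        (Submodule.smul_mem _ _ (ih (by omega)))
  have htop : LinearMap.range (T - μ • 1) ⊔ Submodule.span F {w 0} = ⊤ := by
    rw [eq_top_iff]
    intro v _
    refine (Submodule.span_le.mpr ?_) (h.span v)
    rintro _ ⟨k, hk, rfl⟩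
    exact key k hk
  have h1 := Submodule.finrank_add_le_finrank_add_finrank (LinearMap.range (T - μ • 1))
    (Submodule.span F {w 0})
  rw [htop, finrank_top] at h1
  have h2 := LinearMap.finrank_range_add_finrank_ker (T - μ • (1 : Module.End F V))
  have h3 : Module.finrank F (Submodule.span F {w 0}) ≤ 1 := by
    simpa using finrank_span_le_card (R := F) ({w 0} : Set V)
  rw [Module.End.eigenspace_def]
  omega

theorem injOn_of_iSup_eq_top [FiniteDimensional F V] (h : IsBidiagChain T d ε w)
    (hdim : Module.finrank F V = d + 1) (E : F → Submodule F V)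
    (hE : ∀ μ, T.HasEigenvalue μ → Module.finrank F (E μ) ≤ 1)
    (hE0 : ∀ μ, ¬ T.HasEigenvalue μ → E μ = ⊥) (htop : ⨆ μ, E μ = ⊤) :
    Set.InjOn ε (Finset.range (d + 1)) := by
  classical
  have h1 : (⊤ : Submodule F V) ≤ ((Finset.range (d + 1)).image ε).sup E := by
    rw [← htop]
    refine iSup_le fun μ => ?_
    by_cases hμ : T.HasEigenvalue μ
    · obtain ⟨k, hk, rfl⟩ := h.exists_eq_of_hasEigenvalue hμ
      exact Finset.le_sup (f := E) (Finset.mem_image_of_mem ε hk)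
    · rw [hE0 μ hμ]
      exact bot_le
  have h2 := finrank_finset_sup_le ((Finset.range (d + 1)).image ε) E fun μ _ => by
    by_cases hμ : T.HasEigenvalue μ
    · exact hE μ hμ
    · rw [hE0 μ hμ, finrank_bot]
      exact zero_le_one
  rw [top_le_iff.mp h1, finrank_top, hdim] at h2
  rw [← Finset.card_image_iff]
  have h3 := Finset.card_image_le (s := Finset.range (d + 1)) (f := ε)
  rw [Finset.card_range] at h3 ⊢
  omega

theorem iSup_eigenspace_iff_injOn [IsAlgClosed F] [FiniteDimensional F V]
    (h : IsBidiagChain T d ε w) (hdim : Module.finrank F V = d + 1) :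
    (⨆ μ : F, T.eigenspace μ) = ⊤ ↔ Set.InjOn ε (Finset.range (d + 1)) := by
  refine ⟨h.injOn_of_iSup_eq_top hdim _ (fun μ _ => h.finrank_eigenspace_le_one μ)
    fun μ hμ => not_not.mp hμ, fun hinj => ?_⟩
  exact (Module.End.isSemisimple_of_squarefree_aeval_eq_zero
    (separable_prod_X_sub_C_iff'.mpr fun i hi j hj hij => hinj hi hj hij).squarefree
    h.aeval_prod_eq_zero).iSup_eigenspace_eq_top

theorem finrank_maxGenEigenspace_iff_injOn [IsAlgClosed F] [FiniteDimensional F V]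
    (h : IsBidiagChain T d ε w) (hdim : Module.finrank F V = d + 1) :
    (∀ μ : F, T.HasEigenvalue μ → Module.finrank F (T.maxGenEigenspace μ) = 1) ↔
      Set.InjOn ε (Finset.range (d + 1)) := by
  refine ⟨fun hm => h.injOn_of_iSup_eq_top hdim _ (fun μ hμ => (hm μ hμ).le) (fun μ hμ => ?_)
    (Module.End.iSup_maxGenEigenspace_eq_top T), fun hinj μ hμ => ?_⟩
  · by_contra hne
    exact hμ (Module.End.HasUnifEigenvalue.lt zero_lt_one hne)
  · have hs := Module.End.isSemisimple_of_squarefree_aeval_eq_zero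
      (separable_prod_X_sub_C_iff'.mpr fun i hi j hj hij => hinj hi hj hij).squarefree
      h.aeval_prod_eq_zero
    rw [hs.isFinitelySemisimple.maxGenEigenspace_eq_eigenspace]
    have h1 := h.finrank_eigenspace_le_one μ
    have h2 : Module.finrank F (T.eigenspace μ) ≠ 0 := fun h0 =>
      hμ (Submodule.finrank_eq_zero.mp h0)
    omega

end IsBidiagChain

/-- Coefficients expanding a tridiagonal basis in a bidiagonal one. -/
def dualHahnCoeff {F : Type} [Field F] (g : ℕ → F) (n k : ℕ) : F :=
  (n.choose k : F) * ∏ j ∈ Finset.Ico k n, g (j + 1)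

section DualHahn

variable {F : Type} [Field F] {g t ε κ φ : ℕ → F}

theorem dualHahnCoeff_eq_zero {n k : ℕ} (h : n < k) : dualHahnCoeff g n k = 0 := by
  simp [dualHahnCoeff, Nat.choose_eq_zero_of_lt h]

theorem dualHahnCoeff_self (n : ℕ) : dualHahnCoeff g n n = 1 := by
  simp [dualHahnCoeff]

theorem mul_dualHahnCoeff_pred (hφ : ∀ n, φ n = -((n : F) * g n * t n)) (m k : ℕ) :
    φ (k + m) * dualHahnCoeff g (k + m - 1) k =
      -((m : F) * t (k + m) * dualHahnCoeff g (k + m) k) := by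
  rcases m with _ | m
  · rcases k with _ | k
    · simp [hφ]
    · rw [dualHahnCoeff_eq_zero (by omega)]
      simp
  · have h1 := Nat.choose_mul_succ_eq (k + m) k
    rw [show k + m + 1 - k = m + 1 by omega] at h1
    have h2 : ((k + m).choose k : F) * ((k : F) + m + 1) =
        ((k + m + 1).choose k : F) * ((m : F) + 1) := by
      simpa using congrArg (Nat.cast : ℕ → F) h1
    rw [hφ, show k + (m + 1) - 1 = k + m by omega, dualHahnCoeff, dualHahnCoeff,
      show k + (m + 1) = k + m + 1 by omega, Finset.prod_Ico_succ_top (by omega)]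
    push_cast
    linear_combination (-(g (k + m + 1) * t (k + m + 1) *
      ∏ j ∈ Finset.Ico k (k + m), g (j + 1))) * h2

theorem dualHahnCoeff_succ_zero [CharZero F] (hφ : ∀ n, φ n = -((n : F) * g n * t n))
    (hrec : ∀ n k : ℕ, ((n : F) + 1) * g (n + 1) =
      k * g k + ((n : F) + 1 - k) * (ε k - κ n + ((n : F) - k) * t n)) (n : ℕ) :
    dualHahnCoeff g (n + 1) 0 =
      (ε 0 - κ n) * dualHahnCoeff g n 0 - φ n * dualHahnCoeff g (n - 1) 0 := by
  have h1 := mul_dualHahnCoeff_pred hφ n 0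
  rw [zero_add] at h1
  have h2 := hrec n 0
  have h3 : g (n + 1) = ε 0 - κ n + n * t n := by
    apply mul_left_cancel₀ (Nat.cast_add_one_ne_zero n : (n : F) + 1 ≠ 0)
    rw [h2]; push_cast; ring
  rw [h1, dualHahnCoeff, dualHahnCoeff, Finset.prod_Ico_succ_top (by omega), h3]
  simp only [Nat.choose_zero_right]
  ring

theorem dualHahnCoeff_succ_succ [CharZero F] (hφ : ∀ n, φ n = -((n : F) * g n * t n))
    (hrec : ∀ n k : ℕ, ((n : F) + 1) * g (n + 1) =
      k * g k + ((n : F) + 1 - k) * (ε k - κ n + ((n : F) - k) * t n)) (n k : ℕ) :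
    dualHahnCoeff g (n + 1) (k + 1) = dualHahnCoeff g n k +
      (ε (k + 1) - κ n) * dualHahnCoeff g n (k + 1) -
        φ n * dualHahnCoeff g (n - 1) (k + 1) := by
  rcases lt_trichotomy n k with h | rfl | h
  · rw [dualHahnCoeff_eq_zero (by omega), dualHahnCoeff_eq_zero (by omega),
      dualHahnCoeff_eq_zero (by omega), dualHahnCoeff_eq_zero (by omega)]
    ring
  · rw [dualHahnCoeff_self, dualHahnCoeff_self, dualHahnCoeff_eq_zero (by omega),
      dualHahnCoeff_eq_zero (by omega)]
    ring
  · obtain ⟨m, rfl⟩ : ∃ m, n = k + 1 + m := ⟨n - (k + 1), by omega⟩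
    rw [mul_dualHahnCoeff_pred hφ m (k + 1)]
    have h1 := Nat.choose_mul_succ_eq (k + 1 + m) (k + 1)
    rw [show k + 1 + m + 1 - (k + 1) = m + 1 by omega] at h1
    have h1' : ((k + 1 + m).choose (k + 1) : F) * ((k : F) + 1 + m + 1) =
        ((k + 1 + m + 1).choose (k + 1) : F) * ((m : F) + 1) := by exact_mod_cast h1
    have h2 := Nat.choose_succ_right_eq (k + 1 + m) k
    rw [show k + 1 + m - k = m + 1 by omega] at h2
    have h2' : ((k + 1 + m).choose (k + 1) : F) * ((k : F) + 1) =
        ((k + 1 + m).choose k : F) * ((m : F) + 1) := by exact_mod_cast h2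
    have h3 := hrec (k + 1 + m) (k + 1)
    push_cast at h3
    apply mul_left_cancel₀ (Nat.cast_add_one_ne_zero m : (m : F) + 1 ≠ 0)
    rw [dualHahnCoeff, dualHahnCoeff, dualHahnCoeff, Finset.prod_Ico_succ_top (by omega),
      Finset.prod_eq_prod_Ico_succ_bot (show k < k + 1 + m by omega)]
    set P := ∏ j ∈ Finset.Ico (k + 1) (k + 1 + m), g (j + 1)
    linear_combination (-(P * g (k + 1 + m + 1))) * h1' + (P * g (k + 1)) * h2' +
      P * ((k + 1 + m).choose (k + 1) : F) * h3

variable {V : Type} [AddCommGroup V] [Module F V] {T : Module.End F V} {v w : ℕ → V} {d : ℕ}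

theorem neg_one_pow_smul_eq_sum_dualHahnCoeff [CharZero F]
    (hφ : ∀ n, φ n = -((n : F) * g n * t n))
    (hrec : ∀ n k : ℕ, ((n : F) + 1) * g (n + 1) =
      k * g k + ((n : F) + 1 - k) * (ε k - κ n + ((n : F) - k) * t n))
    (hv : ∀ n ≤ d, T (v n) = κ n • v n - v (n + 1) - φ n • v (n - 1))
    (hw : ∀ k, w (k + 1) = T (w k) - ε k • w k) (h0 : w 0 = v 0) (n : ℕ) (hn : n ≤ d + 1)
    (N : ℕ) (hN : n < N) :
    (-1 : F) ^ n • v n = ∑ k ∈ Finset.range N, dualHahnCoeff g n k • w k := by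
  induction n using Nat.strong_induction_on generalizing N with
  | _ n ih =>
    obtain ⟨M, rfl⟩ : ∃ M, N = M + 1 := ⟨N - 1, by omega⟩
    rcases n with _ | n
    · rw [Finset.sum_range_succ', Finset.sum_eq_zero]
      · simp [dualHahnCoeff_self, h0]
      · intro k _
        rw [dualHahnCoeff_eq_zero (by omega), zero_smul]
    · have h1 := ih n (by omega) (by omega) (M + 1) (by omega)
      have h1' := ih n (by omega) (by omega) M (by omega)
      have h2 : φ n • (-1 : F) ^ (n - 1) • v (n - 1) = φ n • ∑ k ∈ Finset.range (M + 1),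
          dualHahnCoeff g (n - 1) k • w k := by
        rw [ih (n - 1) (by omega) (by omega) (M + 1) (by omega)]
      have h3 : φ n * (-1 : F) ^ (n - 1) = - (φ n * (-1) ^ n) := by
        rcases n with _ | n
        · simp [hφ]
        · rw [Nat.add_sub_cancel]; ring
      have h4 : (-1 : F) ^ (n + 1) • v (n + 1) = T ((-1 : F) ^ n • v n) -
          κ n • ((-1 : F) ^ n • v n) - φ n • (-1 : F) ^ (n - 1) • v (n - 1) := by
        rw [smul_smul (φ n), h3, map_smul, hv n (by omega), pow_succ]
        module
      rw [h4, h2]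
      nth_rewrite 1 [h1']
      rw [h1, map_sum, Finset.sum_range_succ' _ M, Finset.sum_range_succ' _ M,
        Finset.sum_range_succ' _ M, dualHahnCoeff_succ_zero hφ hrec]
      have h5 : ∑ k ∈ Finset.range M, T (dualHahnCoeff g n k • w k) =
          ∑ k ∈ Finset.range M, dualHahnCoeff g n k • w (k + 1) +
          (∑ k ∈ Finset.range M, (dualHahnCoeff g n (k + 1) * ε (k + 1)) • w (k + 1) +
            (dualHahnCoeff g n 0 * ε 0) • w 0) := by
        rw [← Finset.sum_range_succ' (fun k => (dualHahnCoeff g n k * ε k) • w k) M,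
          Finset.sum_range_succ, dualHahnCoeff_eq_zero (show n < M by omega), zero_mul, zero_smul,
          add_zero, ← Finset.sum_add_distrib]
        refine Finset.sum_congr rfl fun k _ => ?_
        rw [hw, map_smul]
        module
      have h6 : ∑ k ∈ Finset.range M, dualHahnCoeff g (n + 1) (k + 1) • w (k + 1) =
          ∑ k ∈ Finset.range M, dualHahnCoeff g n k • w (k + 1) +
          ∑ k ∈ Finset.range M, (dualHahnCoeff g n (k + 1) * ε (k + 1)) • w (k + 1) -
          κ n • ∑ k ∈ Finset.range M, dualHahnCoeff g n (k + 1) • w (k + 1) -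
          φ n • ∑ k ∈ Finset.range M, dualHahnCoeff g (n - 1) (k + 1) • w (k + 1) := by
        rw [Finset.smul_sum, Finset.smul_sum, ← Finset.sum_add_distrib, ← Finset.sum_sub_distrib,
          ← Finset.sum_sub_distrib]
        refine Finset.sum_congr rfl fun k _ => ?_
        rw [dualHahnCoeff_succ_succ hφ hrec]
        module
      rw [h5, h6]
      module

/-- A tridiagonal operator with dual Hahn parameters can be made bidiagonal. -/
theorem isBidiagChain_of_tridiag [CharZero F]
    (hφ : ∀ n, φ n = -((n : F) * g n * t n))
    (hrec : ∀ n k : ℕ, ((n : F) + 1) * g (n + 1) =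
      k * g k + ((n : F) + 1 - k) * (ε k - κ n + ((n : F) - k) * t n))
    (hg : g (d + 1) = 0) (hlast : v (d + 1) = 0)
    (hv : ∀ n ≤ d, T (v n) = κ n • v n - v (n + 1) - φ n • v (n - 1))
    (hspan : ∀ x : V, x ∈ Submodule.span F (v '' Set.Iic d)) :
    ∃ w : ℕ → V, IsBidiagChain T d ε w := by
  let w : ℕ → V := fun k => Nat.rec (v 0) (fun k x => T x - ε k • x) k
  have hw : ∀ k, w (k + 1) = T (w k) - ε k • w k := fun _ => rfl
  refine ⟨w, fun k _ => hw k, ?_, fun x => ?_⟩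
  · have h1 := neg_one_pow_smul_eq_sum_dualHahnCoeff hφ hrec hv hw rfl (d + 1) le_rfl (d + 2)
      (by omega)
    rw [hlast, smul_zero, Finset.sum_range_succ, dualHahnCoeff_self, one_smul,
      Finset.sum_eq_zero, zero_add] at h1
    · exact h1.symm
    · intro k hk
      rw [dualHahnCoeff, Finset.prod_eq_zero (i := d), mul_zero, zero_smul]
      · simp at hk ⊢
        omega
      · exact hg
  · refine Submodule.span_le.mpr ?_ (hspan x)
    rintro _ ⟨n, hn, rfl⟩
    have hn' : n ≤ d := hn
    have h1 := neg_one_pow_smul_eq_sum_dualHahnCoeff hφ hrec hv hw rfl n (by omega) (n + 1)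
      (by omega)
    have h2 : v n = (-1 : F) ^ n • (-1 : F) ^ n • v n := by
      rw [smul_smul, ← mul_pow]
      simp
    rw [h2, h1]
    refine Submodule.smul_mem _ _ (Submodule.sum_mem _ fun k hk => Submodule.smul_mem _ _
      (Submodule.subset_span ⟨k, ?_, rfl⟩))
    simp at hk ⊢
    omega

end DualHahn

theorem thP_injOn_iff {F : Type} [Field F] [CharZero F] (x : F) (d : ℕ) :
    Set.InjOn (thP F x d) (Finset.range (d + 1)) ↔
      ∀ i : ℕ, 1 ≤ i → i < 2 * d → 2 * x ≠ (i : F) - (d : F) - 1 := by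
  have key : ∀ i j : ℕ, thP F x d i - thP F x d j =
      ((j : F) - i) * (2 * x - (((i + j : ℕ) : F) - d - 1)) := by
    intro i j
    simp only [thP]
    push_cast
    ring
  constructor
  · intro h i h1 h2 hx
    obtain ⟨p, q, rfl, hp, hq, hpq⟩ : ∃ p q, i = p + q ∧ p ≤ d ∧ q ≤ d ∧ p ≠ q := by
      by_cases hi : i ≤ d
      · exact ⟨i, 0, by omega, by omega, by omega, by omega⟩
      · exact ⟨d, i - d, by omega, by omega, by omega, by omega⟩
    refine hpq (h (by simp; omega) (by simp; omega) (sub_eq_zero.mp ?_))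
    rw [key, hx, sub_self, mul_zero]
  · intro h i hi j hj hij
    by_contra hne
    simp only [Finset.coe_range, Set.mem_Iio] at hi hj
    have h1 := key i j
    rw [hij, sub_self] at h1
    rcases mul_eq_zero.mp h1.symm with h2 | h2
    · exact hne (Nat.cast_injective (sub_eq_zero.mp h2)).symm
    · exact h (i + j) (by omega) (by omega) (sub_eq_zero.mp h2)

theorem injOn_reflect_iff {α : Type*} (f : ℕ → α) (d : ℕ) :
    Set.InjOn (fun k => f (d - k)) (Finset.range (d + 1)) ↔
      Set.InjOn f (Finset.range (d + 1)) := by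
  simp only [Set.InjOn, Finset.coe_range, Set.mem_Iio]
  constructor
  · intro h i hi j hj hij
    have := @h (d - i) (by omega) (d - j) (by omega)
      (by simpa [Nat.sub_sub_self (show i ≤ d by omega), Nat.sub_sub_self (show j ≤ d by omega)])
    omega
  · intro h i hi j hj hij
    have := @h (d - i) (by omega) (d - j) (by omega) hij
    omega

section BasisSeq

variable {F : Type} [Field F] {V : Type} [AddCommGroup V] [Module F V] {d : ℕ}
  (e : Module.Basis (Fin (d + 1)) F V)

/-- A basis indexed by `0, …, d`, extended by zero. -/
noncomputable def basisSeq (n : ℕ) : V := if h : n < d + 1 then e ⟨n, h⟩ else 0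

theorem basisSeq_val (i : Fin (d + 1)) : basisSeq e i = e i := by
  simp only [basisSeq, i.isLt, dif_pos]

theorem basisSeq_last : basisSeq e (d + 1) = 0 := by
  simp [basisSeq]

theorem mem_span_basisSeq (x : V) : x ∈ Submodule.span F (basisSeq e '' Set.Iic d) := by
  refine Submodule.span_mono ?_ (e.mem_span x)
  rintro _ ⟨i, rfl⟩
  exact ⟨i, Nat.lt_succ_iff.mp i.isLt, basisSeq_val e i⟩

end BasisSeq

section RacahModule

variable {F : Type} [Field F] {V : Type} [AddCommGroup V] [Module F V]
  [Module (RacahAlg F) V] [IsScalarTower F (RacahAlg F) V]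

theorem rC_eq : rC F = rDelta F - rA F - rB F := by
  rw [rDelta]
  abel

theorem two_mul_rD : 2 * rD F = rA F * rB F - rB F * rA F := by
  have h := RingQuot.mkAlgHom_rel F (RacahRel.AB (F := F))
  rw [map_mul, map_ofNat] at h
  simpa [rA, rB, rD] using h.symm

theorem RacahAlg.smul_mem_of_invariant [CharZero F] (N : Submodule F V)
    (hA : ∀ u ∈ N, rA F • u ∈ N) (hB : ∀ u ∈ N, rB F • u ∈ N)
    (hδ : ∀ u ∈ N, rDelta F • u ∈ N) (r : RacahAlg F) : ∀ u ∈ N, r • u ∈ N := by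
  have hC : ∀ u ∈ N, rC F • u ∈ N := fun u hu => by
    rw [rC_eq, sub_smul, sub_smul]
    exact N.sub_mem (N.sub_mem (hδ u hu) (hA u hu)) (hB u hu)
  have hD : ∀ u ∈ N, rD F • u ∈ N := fun u hu => by
    have h1 : (2 : F) • rD F • u = rA F • rB F • u - rB F • rA F • u := by
      rw [← mul_smul, ← mul_smul, ← sub_smul, ← two_mul_rD, two_mul, two_smul, add_smul]
    rw [← inv_smul_smul₀ (two_ne_zero (α := F)) (rD F • u), h1]
    exact N.smul_mem _ (N.sub_mem (hA _ (hB u hu)) (hB _ (hA u hu)))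
  obtain ⟨y, rfl⟩ := RingQuot.mkAlgHom_surjective F (RacahRel F) r
  induction y using FreeAlgebra.induction with
  | grade0 s =>
    intro u hu
    rw [AlgHom.commutes, algebraMap_smul]
    exact N.smul_mem s hu
  | grade1 i =>
    fin_cases i
    · exact hA
    · exact hB
    · exact hC
    · exact hD
  | mul p q hp hq =>
    intro u hu
    rw [map_mul, mul_smul]
    exact hp _ (hq u hu)
  | add p q hp hq =>
    intro u hu
    rw [map_add, add_smul]
    exact N.add_mem (hp u hu) (hq u hu)

variable {a b c : F} {d : ℕ} {s : F} {e : Module.Basis (Fin (d + 1)) F V}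

theorem phP_ne_zero [CharZero F] [IsSimpleModule (RacahAlg F) V]
    (hA : ∀ n ≤ d, rA F • basisSeq e n = thP F a d n • basisSeq e n + basisSeq e (n + 1))
    (hB : ∀ n ≤ d, rB F • basisSeq e n =
      thP F b d n • basisSeq e n + phP F a b c d n • basisSeq e (n - 1))
    (hδ : ∀ u : V, rDelta F • u = s • u) {i : ℕ} (hi : i ≠ 0) (hid : i ≤ d) :
    phP F a b c d i ≠ 0 := by
  intro h0
  let S : Set (Fin (d + 1)) := {j | i ≤ (j : ℕ)}
  let N : Submodule F V := Submodule.span F (e '' S)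
  have hmem : ∀ n, i ≤ n → basisSeq e n ∈ N := by
    intro n hn
    by_cases h : n < d + 1
    · exact Submodule.subset_span ⟨⟨n, h⟩, hn, (basisSeq_val e ⟨n, h⟩).symm⟩
    · simp [basisSeq, h]
  have inv : ∀ r : RacahAlg F, (∀ n, i ≤ n → n ≤ d → r • basisSeq e n ∈ N) →
      ∀ u ∈ N, r • u ∈ N := by
    intro r hr u hu
    have h1 : N ≤ N.comap (opOf F r V) := by
      refine Submodule.span_le.mpr ?_
      rintro _ ⟨j, hj, rfl⟩
      rw [← basisSeq_val]
      exact hr j hj (Nat.lt_succ_iff.mp j.isLt)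
    exact h1 hu
  have hinv := RacahAlg.smul_mem_of_invariant N
    (inv _ fun n hn hnd => by
      rw [hA n hnd]
      exact N.add_mem (N.smul_mem _ (hmem n hn)) (hmem _ (by omega)))
    (inv _ fun n hn hnd => by
      rw [hB n hnd]
      refine N.add_mem (N.smul_mem _ (hmem n hn)) ?_
      rcases hn.eq_or_lt with rfl | hlt
      · rw [h0, zero_smul]
        exact N.zero_mem
      · exact N.smul_mem _ (hmem _ (by omega)))
    (fun u hu => by
      rw [hδ]
      exact N.smul_mem _ hu)
  let N' : Submodule (RacahAlg F) V := { N with smul_mem' := fun r u hu => hinv r u hu }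
  rcases eq_bot_or_eq_top N' with h | h
  · have h1 : e ⟨i, by omega⟩ ∈ N' := Submodule.subset_span ⟨⟨i, by omega⟩, le_refl i, rfl⟩
    rw [h, Submodule.mem_bot] at h1
    exact e.ne_zero _ h1
  · have h1 : e 0 ∈ N' := h ▸ Submodule.mem_top
    have h2 : (0 : Fin (d + 1)) ∈ S := e.self_mem_span_image.mp h1
    exact hi (Nat.le_zero.mp h2)

theorem isBidiagChain_rA
    (hA : ∀ n ≤ d, rA F • basisSeq e n = thP F a d n • basisSeq e n + basisSeq e (n + 1)) :
    IsBidiagChain (opOf F (rA F) V) d (thP F a d) (basisSeq e) where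
  step k hk := by
    change _ = rA F • basisSeq e k - _
    rw [hA k hk, add_sub_cancel_left]
  last := basisSeq_last e
  span := mem_span_basisSeq e

theorem isBidiagChain_rB
    (hB : ∀ n ≤ d, rB F • basisSeq e n =
      thP F b d n • basisSeq e n + phP F a b c d n • basisSeq e (n - 1))
    (hφ : ∀ i ≠ 0, i ≤ d → phP F a b c d i ≠ 0) :
    ∃ w, IsBidiagChain (opOf F (rB F) V) d (fun k => thP F b d (d - k)) w := by
  let w : ℕ → V := fun k =>
    (∏ j ∈ Finset.range k, phP F a b c d (d - j)) • basisSeq e (d - k)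
  have hstep : ∀ k ≤ d, opOf F (rB F) V (w k) - thP F b d (d - k) • w k =
      (∏ j ∈ Finset.range (k + 1), phP F a b c d (d - j)) • basisSeq e (d - (k + 1)) := by
    intro k hk
    have h1 : opOf F (rB F) V (basisSeq e (d - k)) = _ := hB (d - k) (by omega)
    rw [map_smul, h1, Finset.prod_range_succ, Nat.sub_sub]
    module
  refine ⟨w, fun k hk => (hstep k hk).symm, ?_, fun x => ?_⟩
  · simp [w, Finset.prod_range_succ, phP]
  · refine Submodule.span_le.mpr ?_ (mem_span_basisSeq e x)
    rintro _ ⟨n, hn, rfl⟩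
    have hn' : n ≤ d := hn
    have h0 : ∏ j ∈ Finset.range (d - n), phP F a b c d (d - j) ≠ 0 :=
      Finset.prod_ne_zero_iff.mpr fun j hj => by
        rw [Finset.mem_range] at hj
        exact hφ _ (by omega) (by omega)
    have h1 : basisSeq e n = (∏ j ∈ Finset.range (d - n), phP F a b c d (d - j))⁻¹ •
        w (d - n) := by
      simp only [w]
      rw [inv_smul_smul₀ h0, Nat.sub_sub_self hn']
    rw [h1]
    exact Submodule.smul_mem _ _ (Submodule.subset_span ⟨d - n, Nat.sub_le _ _, rfl⟩)

theorem isBidiagChain_rC [CharZero F]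
    (hA : ∀ n ≤ d, rA F • basisSeq e n = thP F a d n • basisSeq e n + basisSeq e (n + 1))
    (hB : ∀ n ≤ d, rB F • basisSeq e n =
      thP F b d n • basisSeq e n + phP F a b c d n • basisSeq e (n - 1))
    (hδ : ∀ u : V, rDelta F • u =
      ((d : F) / 2 * ((d : F) / 2 + 1) + a * (a + 1) + b * (b + 1) + c * (c + 1)) • u) :
    ∃ w, IsBidiagChain (opOf F (rC F) V) d (thP F c d) w := by
  refine isBidiagChain_of_tridiag
    (g := fun j => -(((j : F) - d - 1) * (a + b + c + (d : F) / 2 - j + 2)))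
    (t := fun n => a + b - c + (d : F) / 2 - n + 1) (φ := phP F a b c d)
    (κ := fun n => (d : F) / 2 * ((d : F) / 2 + 1) + a * (a + 1) + b * (b + 1) + c * (c + 1)
      - thP F a d n - thP F b d n)
    (fun n => ?_) (fun n k => ?_) ?_ (basisSeq_last e) (fun n hn => ?_) (mem_span_basisSeq e)
  · simp only [phP]
    ring
  · simp only [thP]
    push_cast
    ring
  · push_cast
    ring
  · change rC F • basisSeq e n = _
    rw [rC_eq, sub_smul, sub_smul, hA n hn, hB n hn, hδ]
    module

end RacahModule

/-- Suppose `R_d(a,b,c)` is irreducible and `(X,x)` is one of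
`(A,a), (B,b), (C,c)`.  TFAE: (i) `X` acts diagonalizably; (ii) `X` acts
multiplicity-freely; (iii) `2x ∉ {i - d - 1 : i = 1, …, 2d-1}`. -/
theorem stmt7 (F : Type) [Field F] [IsAlgClosed F] [CharZero F] (d : ℕ) (a b c : F)
    (V : Type) [AddCommGroup V] [Module (RacahAlg F) V]
    (hV : IsRdModule F a b c d V) (hirr : IsSimpleModule (RacahAlg F) V)
    (X : RacahAlg F) (x : F)
    (hXx : (X = rA F ∧ x = a) ∨ (X = rB F ∧ x = b) ∨ (X = rC F ∧ x = c)) :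
    (ActsDiagOn F X V ↔ ActsMultFreeOn F X V) ∧
    (ActsMultFreeOn F X V ↔
      ∀ i : ℕ, 1 ≤ i → i < 2 * d → 2 * x ≠ (i : F) - (d : F) - 1) := by
  let _ : Module F V := resF F (RacahAlg F) V
  have : IsScalarTower F (RacahAlg F) V := resF_tower F (RacahAlg F) V rfl
  obtain ⟨e, hA, hB, hδ⟩ := hV
  have hA' : ∀ n ≤ d, rA F • basisSeq e n =
      thP F a d n • basisSeq e n + basisSeq e (n + 1) := by
    intro n hn
    have h := hA ⟨n, by omega⟩
    rw [← basisSeq_val] at h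
    exact h
  have hB' : ∀ n ≤ d, rB F • basisSeq e n =
      thP F b d n • basisSeq e n + phP F a b c d n • basisSeq e (n - 1) := by
    intro n hn
    have h := hB ⟨n, by omega⟩
    rw [← basisSeq_val, ← basisSeq_val] at h
    rw [h]
    rcases n with _ | n
    · simp [phP]
    · simp
  have hδ' : ∀ u : V, rDelta F • u = _ • u := hδ
  have : FiniteDimensional F V := Module.Finite.of_basis e
  have hdim : Module.finrank F V = d + 1 := by
    rw [Module.finrank_eq_card_basis e, Fintype.card_fin]
  obtain ⟨ε, w, hw, hε⟩ : ∃ ε w, IsBidiagChain (opOf F X V) d ε w ∧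
      (Set.InjOn ε (Finset.range (d + 1)) ↔ Set.InjOn (thP F x d) (Finset.range (d + 1))) := by
    rcases hXx with ⟨rfl, rfl⟩ | ⟨rfl, rfl⟩ | ⟨rfl, rfl⟩
    · exact ⟨_, _, isBidiagChain_rA hA', Iff.rfl⟩
    · obtain ⟨w, hw⟩ := isBidiagChain_rB hB' fun i hi hid => phP_ne_zero hA' hB' hδ' hi hid
      exact ⟨_, w, hw, injOn_reflect_iff _ d⟩
    · obtain ⟨w, hw⟩ := isBidiagChain_rC hA' hB' hδ'
      exact ⟨_, w, hw, Iff.rfl⟩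
  have h1 : ActsDiagOn F X V ↔ _ := hw.iSup_eigenspace_iff_injOn hdim
  have h2 : ActsMultFreeOn F X V ↔ _ := hw.finrank_maxGenEigenspace_iff_injOn hdim
  exact ⟨h1.trans h2.symm, h2.trans (hε.trans (thP_injOn_iff x d))⟩
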